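/- Let G be a graph such that for every vertex v and every edge e not incident with v, the number of edges disjoint from e and incident with v is even. Then the parity of the number of crossings in a geodesic immersion of G in the 2-sphere is the same for all such immersions. -/

import Mathlib

open scoped Classical

noncomputable section

/-- Points of `ℝ³`. -/
abbrev E3 := EuclideanSpace ℝ (Fin 3)

/-- The interior of the shortest geodesic arc joining `X` and `Y` on the unit
sphere. -/
def ArcInt (X Y : E3) : Set E3 :=
  {z | ∃ a b : ℝ, 0 < a ∧ 0 < b ∧ z = ‖a • X + b • Y‖⁻¹ • (a • X + b • Y)}

/-- Two geodesic edges cross if they share a point interior to both. -/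
def Crosses (X Y Z W : E3) : Prop := (ArcInt X Y ∩ ArcInt Z W).Nonempty

/-- The geodesic arcs of two (unordered) edges `e` and `f` cross. -/
def CrossesE {V : Type*} (v : V → E3) (e f : Sym2 V) : Prop :=
  ∃ a b c d : V, e = s(a, b) ∧ f = s(c, d) ∧ Crosses (v a) (v b) (v c) (v d)

/-- A geodesic immersion of a graph on vertex set `V`: vertices are unit vectors,
no three on a common great circle. -/
def GoodImm {V : Type*} (v : V → E3) : Prop :=
  (∀ i, ‖v i‖ = 1) ∧
    ∀ i j k : V, i ≠ j → i ≠ k → j ≠ k → LinearIndependent ℝ ![v i, v j, v k]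

/-- The number of crossings of a geodesic immersion of the graph `G`: the number of
unordered pairs of vertex-disjoint edges of `G` whose arcs cross. -/
def crossingNum {V : Type*} [Fintype V] [DecidableEq V]
    (G : SimpleGraph V) [DecidableRel G.Adj] (v : V → E3) : ℕ :=
  ((G.edgeFinset.powersetCard 2).filter fun s =>
    ∃ e ∈ s, ∃ f ∈ s, e ≠ f ∧ (∀ x ∈ e, x ∉ f) ∧ CrossesE v e f).card

/-- Three vectors are independent (elementary form). -/
def Ind3 (X Y Z : E3) : Prop :=
  ∀ a b c : ℝ, a • X + b • Y + c • Z = 0 → a = 0 ∧ b = 0 ∧ c = 0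

lemma ind3_iff (X Y Z : E3) : LinearIndependent ℝ ![X, Y, Z] ↔ Ind3 X Y Z := by
  rw [Fintype.linearIndependent_iff]
  constructor
  · intro h a b c habc
    have := h ![a, b, c] (by simpa [Fin.sum_univ_three] using habc)
    exact ⟨this 0, this 1, this 2⟩
  · intro h g hg
    have := h (g 0) (g 1) (g 2) (by simpa [Fin.sum_univ_three] using hg)
    intro i
    fin_cases i
    · exact this.1
    · exact this.2.1
    · exact this.2.2

lemma Ind3.rot {X Y Z : E3} (h : Ind3 X Y Z) : Ind3 Y Z X := by
  intro a b c e
  have := h c a b (by rw [← e]; abel)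
  tauto

lemma Ind3.swap {X Y Z : E3} (h : Ind3 X Y Z) : Ind3 X Z Y := by
  intro a b c e
  have := h a c b (by rw [← e]; abel)
  tauto

lemma Ind3.coords {X Y Z : E3} (h : Ind3 X Y Z) (A : E3) :
    ∃ a b c : ℝ, A = a • X + b • Y + c • Z := by
  have hl := (ind3_iff X Y Z).2 h
  let B := basisOfLinearIndependentOfCardEqFinrank hl (by simp)
  have := B.sum_repr A
  refine ⟨B.repr A 0, B.repr A 1, B.repr A 2, ?_⟩
  rw [Fin.sum_univ_three] at this
  simpa [B] using this.symm

/-- Crossing arcs in terms of positive cones. -/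
lemma crosses_iff {X Y Z W : E3} (h1 : ∀ a b : ℝ, a • X + b • Y = 0 → a = 0)
    (h2 : ∀ a b : ℝ, a • Z + b • W = 0 → a = 0) :
    Crosses X Y Z W ↔ ∃ a b c d : ℝ, 0 < a ∧ 0 < b ∧ 0 < c ∧ 0 < d ∧
      a • X + b • Y = c • Z + d • W := by
  constructor
  · rintro ⟨z, ⟨a, b, ha, hb, hz⟩, ⟨c, d, hc, hd, hz'⟩⟩
    have n1 : 0 < ‖a • X + b • Y‖⁻¹ := by
      rw [inv_pos, norm_pos_iff]
      intro h
      exact ha.ne' (h1 a b h)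
    have n2 : 0 < ‖c • Z + d • W‖⁻¹ := by
      rw [inv_pos, norm_pos_iff]
      intro h
      exact hc.ne' (h2 c d h)
    refine ⟨_, _, _, _, mul_pos n1 ha, mul_pos n1 hb, mul_pos n2 hc, mul_pos n2 hd, ?_⟩
    rw [mul_smul, mul_smul, mul_smul, mul_smul, ← smul_add, ← smul_add, ← hz, ← hz']
  · rintro ⟨a, b, c, d, ha, hb, hc, hd, h⟩
    exact ⟨_, ⟨a, b, ha, hb, rfl⟩, ⟨c, d, hc, hd, by rw [h]⟩⟩

/-- `A` is in the open cone spanned by `X, Y, Z`. -/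
def InTri (X Y Z A : E3) : Prop :=
  ∃ a b c : ℝ, 0 < a ∧ 0 < b ∧ 0 < c ∧ A = a • X + b • Y + c • Z

lemma inTri_coords {X Y Z A : E3} (h : Ind3 X Y Z) {a b c : ℝ}
    (hA : A = a • X + b • Y + c • Z) : InTri X Y Z A ↔ 0 < a ∧ 0 < b ∧ 0 < c := by
  constructor
  · rintro ⟨a', b', c', ha, hb, hc, e⟩
    have := h (a - a') (b - b') (c - c') (by
      rw [sub_smul, sub_smul, sub_smul]
      have : (a • X + b • Y + c • Z) - (a' • X + b' • Y + c' • Z) = 0 := by rw [← hA, ← e, sub_self]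
      rw [← this]; abel)
    obtain ⟨e1, e2, e3⟩ := this
    refine ⟨by linarith, by linarith, by linarith⟩
  · rintro ⟨ha, hb, hc⟩
    exact ⟨a, b, c, ha, hb, hc, hA⟩

lemma crosses_coords {X Y Z A B : E3} (h : Ind3 X Y Z) {a1 a2 a3 b1 b2 b3 : ℝ}
    (hA : A = a1 • X + a2 • Y + a3 • Z) (hB : B = b1 • X + b2 • Y + b3 • Z)
    (hAB : ∀ a b : ℝ, a • A + b • B = 0 → a = 0) (ha3 : a3 ≠ 0) :
    Crosses X Y A B ↔
      (0 < a3 ∧ b3 < 0 ∧ 0 < a3 * b1 - a1 * b3 ∧ 0 < a3 * b2 - a2 * b3) ∨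
      (a3 < 0 ∧ 0 < b3 ∧ a3 * b1 - a1 * b3 < 0 ∧ a3 * b2 - a2 * b3 < 0) := by
  rw [crosses_iff (fun a b e => (h a b 0 (by simpa using e)).1) hAB]
  constructor
  · rintro ⟨s, t, c, d, hs, ht, hc, hd, e⟩
    have := h (c * a1 + d * b1 - s) (c * a2 + d * b2 - t) (c * a3 + d * b3) (by
      have e' : (c • A + d • B) - (s • X + t • Y) = 0 := by rw [e, sub_self]
      rw [← e', hA, hB]
      module)
    obtain ⟨e1, e2, e3⟩ := this
    have k1 : d * (a3 * b1 - a1 * b3) = a3 * s := by linear_combination a3 * e1 - a1 * e3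
    have k2 : d * (a3 * b2 - a2 * b3) = a3 * t := by linear_combination a3 * e2 - a2 * e3
    rcases lt_or_gt_of_ne ha3 with hn | hp
    · right
      refine ⟨hn, ?_, ?_, ?_⟩
      · by_contra hb
        nlinarith [mul_neg_of_pos_of_neg hc hn]
      · by_contra hb
        nlinarith [mul_neg_of_neg_of_pos hn hs]
      · by_contra hb
        nlinarith [mul_neg_of_neg_of_pos hn ht]
    · left
      refine ⟨hp, ?_, ?_, ?_⟩
      · by_contra hb
        nlinarith [mul_pos hc hp]
      · by_contra hb
        nlinarith [mul_pos hp hs]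
      · by_contra hb
        nlinarith [mul_pos hp ht]
  · rintro (⟨h1, h2, h3, h4⟩ | ⟨h1, h2, h3, h4⟩)
    · refine ⟨_, _, -b3, a3, h3, h4, by linarith, h1, ?_⟩
      rw [hA, hB]
      module
    · refine ⟨-(a3 * b1 - a1 * b3), -(a3 * b2 - a2 * b3), b3, -a3, by linarith, by linarith, h2,
        by linarith, ?_⟩
      rw [hA, hB]
      module

/-- Indicator with values in `ZMod 2`. -/
def ind2 (p : Prop) : ZMod 2 := if p then 1 else 0

lemma ind2_of_bool {c1 c2 c3 i j : Prop} {x1 x2 x3 y z : Bool} (h1 : c1 ↔ x1 = true)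
    (h2 : c2 ↔ x2 = true) (h3 : c3 ↔ x3 = true) (h4 : i ↔ y = true) (h5 : j ↔ z = true)
    (h : xor (xor x1 x2) x3 = xor y z) :
    ind2 c1 + ind2 c2 = ind2 c3 + (ind2 i + ind2 j) := by
  simp only [ind2, h1, h2, h3, h4, h5]
  clear h1 h2 h3 h4 h5
  revert x1 x2 x3 y z
  decide

/-- Combinatorial core: sign patterns. -/
lemma sign_core : ∀ p1 p2 p3 q1 q2 q3 r1 r2 r3 : Bool,
    ((p2 == q3) ≠ (p3 == q2) → r1 = (p2 == q3)) →
    ((p3 == q1) ≠ (p1 == q3) → r2 = (p3 == q1)) →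
    ((p1 == q2) ≠ (p2 == q1) → r3 = (p1 == q2)) →
    ¬ ((p1 == r1) = (p2 == r2) ∧ (p2 == r2) = (p3 == r3)) →
    ¬ ((q1 == r1) = (q2 == r2) ∧ (q2 == r2) = (q3 == r3)) →
    xor (xor (p2 && !q2 && r1 && !r3 || !p2 && q2 && !r1 && r3)
      (p1 && !q1 && r3 && !r2 || !p1 && q1 && !r3 && r2))
     (p3 && !q3 && r2 && !r1 || !p3 && q3 && !r2 && r1)
     = xor (p1 && p2 && p3) (q1 && q2 && q3) := by
  decide

lemma sgn_mul {x y : ℝ} (hx : x ≠ 0) (hy : y ≠ 0) :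
    decide (0 < x * y) = (decide (0 < x) == decide (0 < y)) := by
  rcases lt_or_gt_of_ne hx with h | h <;> rcases lt_or_gt_of_ne hy with h' | h'
  · simp [mul_pos_of_neg_of_neg h h', h.not_gt, h'.not_gt]
  · simp [(mul_neg_of_neg_of_pos h h').not_gt, h.not_gt, h']
  · simp [(mul_neg_of_pos_of_neg h h').not_gt, h, h'.not_gt]
  · simp [mul_pos h h', h, h']

lemma sgn_sub {u v m : ℝ} (hv : v ≠ 0) (hm : m = u - v) :
    decide (0 < u) ≠ decide (0 < v) → decide (0 < m) = decide (0 < u) := by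
  intro h
  rcases lt_or_gt_of_ne hv with h' | h'
  · have : 0 < u := by
      by_contra hu
      simp [hu, h'.not_gt] at h
    have : 0 < m := by linarith
    rw [decide_eq_decide]
    tauto
  · have : ¬ 0 < u := by
      intro hu
      simp [hu, h'] at h
    have : ¬ 0 < m := by
      push Not at *
      linarith
    rw [decide_eq_decide]
    tauto

lemma sgn_sum {u v w : ℝ} (hv : v ≠ 0) (h : u + v + w = 0) :
    ¬ (decide (0 < u) = decide (0 < v) ∧ decide (0 < v) = decide (0 < w)) := by
  simp only [decide_eq_decide]
  rintro ⟨h1, h2⟩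
  rcases lt_or_gt_of_ne hv with h' | h'
  · have : ¬ 0 < u := fun k => by linarith [h1.1 k]
    have : ¬ 0 < w := fun k => by linarith [h2.2 k]
    push Not at *
    linarith
  · linarith [h1.2 h', h2.1 h']

lemma minor_ne {X Y Z A B : E3} (h : Ind3 X A B) {a1 a2 a3 b1 b2 b3 : ℝ}
    (hA : A = a1 • X + a2 • Y + a3 • Z) (hB : B = b1 • X + b2 • Y + b3 • Z) (ha : a2 ≠ 0) :
    a2 * b3 - a3 * b2 ≠ 0 := by
  intro e
  have := h (-(b2 * a1 - a2 * b1)) b2 (-a2) (by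
    rw [hA, hB]
    have e' : (a2 * b3 - a3 * b2) • Z = 0 := by rw [e, zero_smul]
    rw [← neg_eq_zero, ← e']
    module)
  exact ha (neg_eq_zero.1 this.2.2)

lemma coord_ne {X Y Z A : E3} (h : Ind3 A Y Z) {a1 a2 a3 : ℝ}
    (hA : A = a1 • X + a2 • Y + a3 • Z) : a1 ≠ 0 := by
  intro e
  have := h 1 (-a2) (-a3) (by rw [hA, e]; module)
  exact one_ne_zero this.1

/-- A geodesic arc crosses the boundary of a triangle an even number of times iff
its endpoints are on the same side. -/
lemma triangle_parity {P Q U A B : E3} (h : Ind3 P Q U)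
    (hA1 : Ind3 A Q U) (hA2 : Ind3 A P U) (hA3 : Ind3 A P Q)
    (hB1 : Ind3 B Q U) (hB2 : Ind3 B P U) (hB3 : Ind3 B P Q)
    (hP : Ind3 P A B) (hQ : Ind3 Q A B) (hU : Ind3 U A B) :
    ind2 (Crosses P U A B) + ind2 (Crosses Q U A B) =
      ind2 (Crosses P Q A B) + (ind2 (InTri P Q U A) + ind2 (InTri P Q U B)) := by
  obtain ⟨a1, a2, a3, hA⟩ := h.coords A
  obtain ⟨b1, b2, b3, hB⟩ := h.coords B
  have hA' : A = a2 • Q + a3 • U + a1 • P := by rw [hA]; abel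
  have hA'' : A = a3 • U + a1 • P + a2 • Q := by rw [hA]; abel
  have hB' : B = b2 • Q + b3 • U + b1 • P := by rw [hB]; abel
  have hB'' : B = b3 • U + b1 • P + b2 • Q := by rw [hB]; abel
  have na1 := coord_ne hA1 hA
  have na2 := coord_ne hA2.swap hA'
  have na3 := coord_ne hA3 hA''
  have nb1 := coord_ne hB1 hB
  have nb2 := coord_ne hB2.swap hB'
  have nb3 := coord_ne hB3 hB''
  obtain ⟨m1, hm1⟩ : ∃ m, m = a2 * b3 - a3 * b2 := ⟨_, rfl⟩
  obtain ⟨m2, hm2⟩ : ∃ m, m = a3 * b1 - a1 * b3 := ⟨_, rfl⟩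
  obtain ⟨m3, hm3⟩ : ∃ m, m = a1 * b2 - a2 * b1 := ⟨_, rfl⟩
  have nm1 : m1 ≠ 0 := hm1 ▸ minor_ne hP hA hB na2
  have nm2 : m2 ≠ 0 := hm2 ▸ minor_ne hQ hA' hB' na3
  have nm3 : m3 ≠ 0 := hm3 ▸ minor_ne hU hA'' hB'' na1
  have hAB : ∀ a b : ℝ, a • A + b • B = 0 → a = 0 := fun a b e =>
    (hP 0 a b (by simpa using e)).2.1
  have c1 := crosses_coords h hA hB hAB na3
  have c2 := crosses_coords h.rot hA' hB' hAB na1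
  have c3 := crosses_coords (X := P) (Y := U) (Z := Q) h.swap
    (show A = a1 • P + a3 • U + a2 • Q by rw [hA]; abel)
    (show B = b1 • P + b3 • U + b2 • Q by rw [hB]; abel) hAB na2
  rw [c1, c2, c3, inTri_coords h hA, inTri_coords h hB]
  have neg : ∀ x : ℝ, x ≠ 0 → (x < 0 ↔ ¬ 0 < x) := fun x hx =>
    ⟨fun k => k.not_gt, fun k => lt_of_le_of_ne (not_lt.1 k) hx⟩
  have key := sign_core (decide (0 < a1)) (decide (0 < a2)) (decide (0 < a3))
    (decide (0 < b1)) (decide (0 < b2)) (decide (0 < b3))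
    (decide (0 < m1)) (decide (0 < m2)) (decide (0 < m3))
    (by rw [← sgn_mul na2 nb3, ← sgn_mul na3 nb2]; exact sgn_sub (mul_ne_zero na3 nb2) hm1)
    (by rw [← sgn_mul na3 nb1, ← sgn_mul na1 nb3]; exact sgn_sub (mul_ne_zero na1 nb3) hm2)
    (by rw [← sgn_mul na1 nb2, ← sgn_mul na2 nb1]; exact sgn_sub (mul_ne_zero na2 nb1) hm3)
    (by
      rw [← sgn_mul na1 nm1, ← sgn_mul na2 nm2, ← sgn_mul na3 nm3]
      exact sgn_sum (mul_ne_zero na2 nm2)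
        (by rw [hm1, hm2, hm3]; ring))
    (by
      rw [← sgn_mul nb1 nm1, ← sgn_mul nb2 nm2, ← sgn_mul nb3 nm3]
      exact sgn_sum (mul_ne_zero nb2 nm2)
        (by rw [hm1, hm2, hm3]; ring))
  have E1 : a3 * b2 - a2 * b3 = -m1 := by rw [hm1]; ring
  have E2 : a1 * b3 - a3 * b1 = -m2 := by rw [hm2]; ring
  have E3' : a2 * b1 - a1 * b2 = -m3 := by rw [hm3]; ring
  rw [← hm1, ← hm2, ← hm3, E1, E2, E3']
  simp only [neg_pos, neg_lt_zero, neg _ na1, neg _ na2, neg _ na3, neg _ nb1, neg _ nb2,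
    neg _ nb3, neg _ nm1, neg _ nm2, neg _ nm3]
  clear c1 c2 c3 E1 E2 E3'
  refine ind2_of_bool ?_ ?_ ?_ ?_ ?_ key <;>
    simp only [Bool.or_eq_true, Bool.and_eq_true, Bool.not_eq_true', decide_eq_true_eq,
      decide_eq_false_iff_not] <;> tauto

/-- General position without normalisation. -/
def Gen {V : Type*} (v : V → E3) : Prop :=
  ∀ i j k : V, i ≠ j → i ≠ k → j ≠ k → Ind3 (v i) (v j) (v k)

lemma arcInt_comm (X Y : E3) : ArcInt X Y = ArcInt Y X := by
  ext z
  constructor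
  · rintro ⟨a, b, ha, hb, h⟩
    exact ⟨b, a, hb, ha, by rw [h, add_comm]⟩
  · rintro ⟨a, b, ha, hb, h⟩
    exact ⟨b, a, hb, ha, by rw [h, add_comm]⟩

lemma crosses_swap1 (X Y Z W : E3) : Crosses X Y Z W ↔ Crosses Y X Z W := by
  unfold Crosses
  rw [arcInt_comm X Y]

lemma crosses_swap2 (X Y Z W : E3) : Crosses X Y Z W ↔ Crosses X Y W Z := by
  unfold Crosses
  rw [arcInt_comm Z W]

lemma crosses_symm (X Y Z W : E3) : Crosses X Y Z W ↔ Crosses Z W X Y := by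
  unfold Crosses
  rw [Set.inter_comm]

lemma crossesE_mk {V : Type*} (v : V → E3) (a b c d : V) :
    CrossesE v s(a, b) s(c, d) ↔ Crosses (v a) (v b) (v c) (v d) := by
  constructor
  · rintro ⟨a', b', c', d', h1, h2, h⟩
    rw [Sym2.eq_iff] at h1 h2
    rcases h1 with ⟨rfl, rfl⟩ | ⟨rfl, rfl⟩ <;> rcases h2 with ⟨rfl, rfl⟩ | ⟨rfl, rfl⟩
    · exact h
    · rwa [crosses_swap2]
    · rwa [crosses_swap1]
    · rwa [crosses_swap1, crosses_swap2]
  · intro h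
    exact ⟨a, b, c, d, rfl, rfl, h⟩

lemma crossesE_symm {V : Type*} (v : V → E3) (e f : Sym2 V) :
    CrossesE v e f ↔ CrossesE v f e := by
  induction e with | _ a b
  induction f with | _ c d
  rw [crossesE_mk, crossesE_mk, crosses_symm]

lemma crossesE_congr {V : Type*} {v v' : V → E3} {e f : Sym2 V}
    (he : ∀ y ∈ e, v y = v' y) (hf : ∀ y ∈ f, v y = v' y) :
    CrossesE v e f ↔ CrossesE v' e f := by
  induction e with | _ a b
  induction f with | _ c d
  rw [crossesE_mk, crossesE_mk, he a (by simp), he b (by simp), hf c (by simp), hf d (by simp)]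

/-- The arc `e` crosses the arc `PQ`. -/
def CrossArc {V : Type*} (v : V → E3) (P Q : E3) (e : Sym2 V) : Prop :=
  ∃ a b, e = s(a, b) ∧ Crosses P Q (v a) (v b)

lemma crossArc_mk {V : Type*} (v : V → E3) (P Q : E3) (a b : V) :
    CrossArc v P Q s(a, b) ↔ Crosses P Q (v a) (v b) := by
  constructor
  · rintro ⟨a', b', h1, h⟩
    rw [Sym2.eq_iff] at h1
    rcases h1 with ⟨rfl, rfl⟩ | ⟨rfl, rfl⟩
    · exact h
    · rwa [crosses_swap2]
  · intro h
    exact ⟨a, b, rfl, h⟩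

/-- The vertex `y` lies in the triangle `P, Q, u` where `f = xu`. -/
def TriE {V : Type*} (v : V → E3) (P Q : E3) (x : V) (f : Sym2 V) (y : V) : Prop :=
  ∃ u, f = s(x, u) ∧ InTri P Q (v u) (v y)

lemma triE_mk {V : Type*} (v : V → E3) (P Q : E3) (x u y : V) :
    TriE v P Q x s(x, u) y ↔ InTri P Q (v u) (v y) := by
  constructor
  · rintro ⟨u', h1, h⟩
    rw [Sym2.congr_right] at h1
    rwa [h1]
  · intro h
    exact ⟨u, rfl, h⟩

/-- Genericity of a new vector with respect to a configuration. -/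
def Avoid {V : Type*} (v : V → E3) (q : E3) : Prop :=
  ∀ j k : V, ∀ a b : ℝ, q ≠ a • v j + b • v k

lemma Avoid.ind {V : Type*} {v : V → E3} {q : E3} (h : Avoid v q) {j k : V}
    (hjk : ∀ a b : ℝ, a • v j + b • v k = 0 → a = 0 ∧ b = 0) : Ind3 q (v j) (v k) := by
  intro a b c e
  have ha : a = 0 := by
    by_contra ha
    refine h j k (-(a⁻¹ * b)) (-(a⁻¹ * c)) ?_
    have : a⁻¹ • (a • q + b • v j + c • v k) = 0 := by rw [e, smul_zero]
    rw [smul_add, smul_add, smul_smul, inv_mul_cancel₀ ha, one_smul] at this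
    rw [← sub_eq_zero, ← this]
    module
  subst ha
  have := hjk b c (by simpa using e)
  tauto

lemma Gen.pair {V : Type*} {v : V → E3} (h : Gen v) {x j k : V} (h1 : x ≠ j) (h2 : x ≠ k)
    (h3 : j ≠ k) (a b : ℝ) (e : a • v j + b • v k = 0) : a = 0 ∧ b = 0 := by
  have := h x j k h1 h2 h3 0 a b (by simpa using e)
  tauto

lemma Gen.update {V : Type*} [DecidableEq V] {v : V → E3} (h : Gen v) {q : E3} (hq : Avoid v q)
    (x : V) : Gen (Function.update v x q) := by
  have key : ∀ j k, x ≠ j → x ≠ k → j ≠ k → Ind3 q (v j) (v k) := fun j k h1 h2 h3 =>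
    hq.ind (h.pair h1 h2 h3)
  intro i j k hij hik hjk
  by_cases hi : i = x
  · subst hi
    rw [Function.update_self, Function.update_of_ne hij.symm, Function.update_of_ne hik.symm]
    exact key j k hij hik hjk
  by_cases hj : j = x
  · subst hj
    rw [Function.update_self, Function.update_of_ne hij, Function.update_of_ne hjk.symm]
    exact (key k i hjk hij.symm hik.symm).rot.rot
  by_cases hk : k = x
  · subst hk
    rw [Function.update_self, Function.update_of_ne hik, Function.update_of_ne hjk]
    exact (key i j hik.symm hjk.symm hij).rot
  rw [Function.update_of_ne hi, Function.update_of_ne hj, Function.update_of_ne hk]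
  exact h i j k hij hik hjk

lemma exists_avoid {V : Type*} [Finite V] (v w : V → E3) : ∃ q, Avoid v q ∧ Avoid w q := by
  let p : (V × V) ⊕ (V × V) → Submodule ℝ E3 :=
    Sum.elim (fun jk => Submodule.span ℝ {v jk.1, v jk.2})
      (fun jk => Submodule.span ℝ {w jk.1, w jk.2})
  have hp : ∀ X Y : E3, Submodule.span ℝ {X, Y} ≠ ⊤ := by
    intro X Y e
    have h1 : Module.finrank ℝ (Submodule.span ℝ (({X, Y} : Finset E3) : Set E3)) ≤ _ :=
      finrank_span_finset_le_card _
    have h2 := Finset.card_le_two (a := X) (b := Y)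
    rw [Finset.coe_pair, e, finrank_top] at h1
    simp at h1
    omega
  have hne : (⋃ i, (p i : Set E3)) ≠ Set.univ := by
    intro hc
    obtain ⟨i, hi⟩ := Subspace.exists_eq_top_of_iUnion_eq_univ hc
    rcases i with i | i
    · exact hp _ _ hi
    · exact hp _ _ hi
  rw [Set.ne_univ_iff_exists_notMem] at hne
  obtain ⟨q, hq⟩ := hne
  rw [Set.mem_iUnion, not_exists] at hq
  refine ⟨q, ?_, ?_⟩
  · intro j k a b e
    exact hq (Sum.inl (j, k)) (Submodule.mem_span_pair.2 ⟨a, b, e.symm⟩)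
  · intro j k a b e
    exact hq (Sum.inr (j, k)) (Submodule.mem_span_pair.2 ⟨a, b, e.symm⟩)

/-- The local identity for a pair of disjoint edges. -/
lemma edge_parity {V : Type*} [Fintype V] [DecidableEq V] {v : V → E3} (h : Gen v) {q : E3}
    (hq : Avoid v q)
    (x : V) (e f : Sym2 V) (he : ¬ e.IsDiag) (hf : ¬ f.IsDiag) (hx : x ∈ f)
    (hd : ∀ y ∈ e, y ∉ f) :
    ind2 (CrossesE v e f) + ind2 (CrossesE (Function.update v x q) e f) =
      ind2 (CrossArc v (v x) q e) +
        ∑ y : V, if y ∈ e then ind2 (TriE v (v x) q x f y) else 0 := by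
  obtain ⟨u, rfl⟩ := hx
  induction e with | _ a b
  have hab : a ≠ b := by simpa using he
  have hxu : x ≠ u := by simpa using hf
  have ha := hd a (by simp)
  have hb := hd b (by simp)
  simp only [Sym2.mem_iff, not_or] at ha hb
  obtain ⟨hax, hau⟩ := ha
  obtain ⟨hbx, hbu⟩ := hb
  replace hax : a ≠ x := hax
  replace hau : a ≠ u := hau
  replace hbx : b ≠ x := hbx
  replace hbu : b ≠ u := hbu
  have hsum : (∑ y : V, if y ∈ s(a, b) then ind2 (TriE v (v x) q x s(x, u) y) else 0) =
      ind2 (InTri (v x) q (v u) (v a)) + ind2 (InTri (v x) q (v u) (v b)) := by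
    rw [← Finset.sum_filter, ← triE_mk v (v x) q x u a, ← triE_mk v (v x) q x u b,
      ← Finset.sum_pair (f := fun y => ind2 (TriE v (v x) q x s(x, u) y)) hab]
    congr 1
    ext y
    simp
  rw [hsum, crossesE_mk, crossesE_mk, crossArc_mk, Function.update_self,
    Function.update_of_ne hxu.symm, Function.update_of_ne hax, Function.update_of_ne hbx,
    crosses_symm (v a), crosses_symm (v a)]
  have I : ∀ {z j k}, z ≠ j → z ≠ k → j ≠ k → Ind3 q (v j) (v k) := fun h1 h2 h3 =>
    hq.ind (h.pair h1 h2 h3)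
  refine triangle_parity ?_ ?_ ?_ ?_ ?_ ?_ ?_ ?_ ?_ ?_
  · exact (I hau hax hxu.symm).rot.rot
  · exact (I hax.symm hxu hau).rot.swap
  · exact h _ _ _ hax hau hxu
  · exact (I hau.symm hxu.symm hax).rot
  · exact (I hbx.symm hxu hbu).rot.swap
  · exact h _ _ _ hbx hbu hxu
  · exact (I hbu.symm hxu.symm hbx).rot
  · exact h _ _ _ hax.symm hbx.symm hab
  · exact I hax.symm hbx.symm hab
  · exact h _ _ _ (Ne.symm hau) (Ne.symm hbu) hab

lemma ind2_card {α : Type*} (s : Finset α) (p : α → Prop) [DecidablePred p] :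
    ((s.filter p).card : ZMod 2) = ∑ i ∈ s, ind2 (p i) := by
  rw [Finset.card_filter]
  push_cast
  refine Finset.sum_congr rfl fun i _ => ?_
  by_cases hi : p i <;> simp [ind2, hi]

/-- Splitting of the crossing number at a vertex. -/
lemma crossingNum_split {V : Type*} [Fintype V] [DecidableEq V]
    (G : SimpleGraph V) [DecidableRel G.Adj] (v : V → E3) (x : V) :
    crossingNum G v =
      ((G.edgeFinset.powersetCard 2).filter fun s => (∀ e ∈ s, x ∉ e) ∧
        ∃ e ∈ s, ∃ f ∈ s, e ≠ f ∧ (∀ y ∈ e, y ∉ f) ∧ CrossesE v e f).card +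
      (((G.edgeFinset ×ˢ G.edgeFinset).filter fun p => x ∈ p.2 ∧ ∀ y ∈ p.1, y ∉ p.2).filter
        fun p => CrossesE v p.1 p.2).card := by
  unfold crossingNum
  rw [← Finset.card_filter_add_card_filter_not (fun s : Finset (Sym2 V) => ∀ e ∈ s, x ∉ e)]
  congr 1
  · rw [Finset.filter_filter]
    congr 1
    ext s
    simp only [Finset.mem_filter]
    exact and_congr_right fun _ => and_comm
  · symm
    refine Finset.card_bij (fun p _ => {p.1, p.2}) ?_ ?_ ?_
    · rintro ⟨e, f⟩ hp
      simp only [Finset.mem_filter, Finset.mem_product] at hp ⊢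
      obtain ⟨⟨⟨he, hf⟩, hx, hd⟩, hc⟩ := hp
      have hne : e ≠ f := by
        rintro rfl
        exact hd x hx hx
      refine ⟨⟨?_, e, by simp, f, by simp, hne, hd, hc⟩, fun h => h f (by simp) hx⟩
      rw [Finset.mem_powersetCard]
      refine ⟨?_, Finset.card_pair hne⟩
      intro g hg
      simp only [Finset.mem_insert, Finset.mem_singleton] at hg
      rcases hg with rfl | rfl <;> assumption
    · rintro ⟨e, f⟩ hp ⟨e', f'⟩ hp' heq
      simp only [Finset.mem_filter, Finset.mem_product] at hp hp'
      obtain ⟨⟨_, hx, hd⟩, _⟩ := hp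
      obtain ⟨⟨_, hx', hd'⟩, _⟩ := hp'
      have m1 : e ∈ ({e', f'} : Finset (Sym2 V)) := by rw [← heq]; simp
      have m2 : f ∈ ({e', f'} : Finset (Sym2 V)) := by rw [← heq]; simp
      have n1 : e ≠ f' := by
        rintro rfl
        exact hd x hx' hx
      have n2 : f ≠ e' := by
        rintro rfl
        exact hd' x hx hx'
      simp only [Finset.mem_insert, Finset.mem_singleton] at m1 m2
      rw [m1.resolve_right n1, m2.resolve_left n2]
    · intro s hs
      simp only [Finset.mem_filter, Finset.mem_powersetCard] at hs
      obtain ⟨⟨⟨hsub, hcard⟩, e, he, f, hf, hne, hd, hc⟩, hx⟩ := hs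
      have hs : ({e, f} : Finset (Sym2 V)) = s := by
        refine Finset.eq_of_subset_of_card_le ?_ (by rw [hcard, Finset.card_pair hne])
        intro g hg
        simp only [Finset.mem_insert, Finset.mem_singleton] at hg
        rcases hg with rfl | rfl <;> assumption
      by_cases hxf : x ∈ f
      · refine ⟨(e, f), ?_, hs⟩
        simp only [Finset.mem_filter, Finset.mem_product]
        exact ⟨⟨⟨hsub he, hsub hf⟩, hxf, hd⟩, hc⟩
      · have hxe : x ∈ e := by
          by_contra hxe
          apply hx
          intro g hg
          rw [← hs] at hg
          simp only [Finset.mem_insert, Finset.mem_singleton] at hg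
          rcases hg with rfl | rfl <;> assumption
        refine ⟨(f, e), ?_, by rw [← hs, Finset.pair_comm]⟩
        simp only [Finset.mem_filter, Finset.mem_product]
        exact ⟨⟨⟨hsub hf, hsub he⟩, hxe, fun y hy hy' => hd y hy' hy⟩,
          (crossesE_symm v e f).1 hc⟩

/-- Moving one vertex does not change the parity. -/
lemma move_parity {V : Type*} [Fintype V] [DecidableEq V]
    (G : SimpleGraph V) [DecidableRel G.Adj]
    (hpar : ∀ (x : V) (e : Sym2 V), e ∈ G.edgeSet → x ∉ e →
      Even ((G.edgeFinset.filter fun f => x ∈ f ∧ ∀ y ∈ e, y ∉ f).card))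
    (v : V → E3) (h : Gen v) (q : E3) (hq : Avoid v q) (x : V) :
    (crossingNum G v : ZMod 2) = crossingNum G (Function.update v x q) := by
  rw [crossingNum_split G v x, crossingNum_split G (Function.update v x q) x]
  push_cast
  congr 1
  · congr 2
    refine Finset.filter_congr fun s _ => and_congr_right fun hs => ?_
    have hu : ∀ e ∈ s, ∀ y ∈ e, v y = Function.update v x q y := by
      intro e he y hy
      rw [Function.update_of_ne]
      rintro rfl
      exact hs e he hy
    constructor
    · rintro ⟨e, he, f, hf, h1, h2, h3⟩
      exact ⟨e, he, f, hf, h1, h2, (crossesE_congr (hu e he) (hu f hf)).1 h3⟩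
    · rintro ⟨e, he, f, hf, h1, h2, h3⟩
      exact ⟨e, he, f, hf, h1, h2, (crossesE_congr (hu e he) (hu f hf)).2 h3⟩
  · have two : ∀ a b : ZMod 2, a + b = 0 → a = b := by decide
    apply two
    rw [ind2_card, ind2_card, ← Finset.sum_add_distrib]
    have hpar' : ∀ (x : V) (e : Sym2 V), e ∈ G.edgeSet →
        ((G.edgeFinset.filter fun f => x ∈ f ∧ ∀ y ∈ e, y ∉ f).card : ZMod 2) = 0 := by
      intro x e he
      by_cases hx : x ∈ e
      · rw [Finset.filter_false_of_mem]
        · simp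
        · rintro f _ ⟨h1, h2⟩
          exact h2 x hx h1
      · exact (ZMod.natCast_eq_zero_iff_even).2 (hpar x e he hx)
    have hE : ∀ p ∈ (G.edgeFinset ×ˢ G.edgeFinset).filter
        (fun p => x ∈ p.2 ∧ ∀ y ∈ p.1, y ∉ p.2),
        ind2 (CrossesE v p.1 p.2) + ind2 (CrossesE (Function.update v x q) p.1 p.2) =
        ind2 (CrossArc v (v x) q p.1) +
        ∑ y : V, if y ∈ p.1 then ind2 (TriE v (v x) q x p.2 y) else 0 := by
      rintro ⟨e, f⟩ hp
      simp only [Finset.mem_filter, Finset.mem_product, SimpleGraph.mem_edgeFinset] at hp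
      obtain ⟨⟨he, hf⟩, hx, hd⟩ := hp
      exact edge_parity h hq x e f (G.not_isDiag_of_mem_edgeSet he)
        (G.not_isDiag_of_mem_edgeSet hf) hx hd
    rw [Finset.sum_congr rfl hE, Finset.sum_add_distrib, Finset.sum_filter, Finset.sum_filter,
      Finset.sum_product, Finset.sum_product_right]
    have z1 : ∀ e ∈ G.edgeFinset, (∑ f ∈ G.edgeFinset,
        if x ∈ f ∧ ∀ y ∈ e, y ∉ f then ind2 (CrossArc v (v x) q e) else 0) = 0 := by
      intro e he
      rw [← Finset.sum_filter, Finset.sum_const, nsmul_eq_mul,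
        hpar' x e (SimpleGraph.mem_edgeFinset.1 he), zero_mul]
    have z2 : ∀ f ∈ G.edgeFinset, (∑ e ∈ G.edgeFinset,
        if x ∈ f ∧ ∀ y ∈ e, y ∉ f then
          (∑ y : V, if y ∈ e then ind2 (TriE v (v x) q x f y) else 0) else 0) = 0 := by
      intro f hf
      by_cases hx : x ∈ f
      · simp only [hx, true_and]
        rw [← Finset.sum_filter, Finset.sum_comm]
        refine Finset.sum_eq_zero fun y _ => ?_
        rw [← Finset.sum_filter, Finset.sum_const, nsmul_eq_mul, Finset.filter_filter]
        have := hpar' y f (SimpleGraph.mem_edgeFinset.1 hf)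
        have hfe : (G.edgeFinset.filter fun e => (∀ y ∈ e, y ∉ f) ∧ y ∈ e) =
            G.edgeFinset.filter fun e => y ∈ e ∧ ∀ z ∈ f, z ∉ e := by
          refine Finset.filter_congr fun e _ => ?_
          constructor
          · rintro ⟨h1, h2⟩
            exact ⟨h2, fun z hz hz' => h1 z hz' hz⟩
          · rintro ⟨h1, h2⟩
            exact ⟨fun z hz hz' => h2 z hz' hz, h1⟩
        rw [hfe, this, zero_mul]
      · simp [hx]
    rw [Finset.sum_eq_zero z1, Finset.sum_eq_zero z2, add_zero]

/-- Any two generic configurations have the same crossing parity. -/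
lemma parity_main {V : Type*} [Fintype V] [DecidableEq V]
    (G : SimpleGraph V) [DecidableRel G.Adj]
    (hpar : ∀ (x : V) (e : Sym2 V), e ∈ G.edgeSet → x ∉ e →
      Even ((G.edgeFinset.filter fun f => x ∈ f ∧ ∀ y ∈ e, y ∉ f).card)) (n : ℕ) :
    ∀ v w : V → E3, Gen v → Gen w → (Finset.univ.filter fun x => v x ≠ w x).card = n →
      (crossingNum G v : ZMod 2) = crossingNum G w := by
  induction n with
  | zero =>
    intro v w _ _ hc
    have : v = w := by
      funext x
      by_contra hx
      rw [Finset.card_eq_zero] at hc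
      have : x ∈ Finset.univ.filter fun x => v x ≠ w x := by simpa using hx
      rw [hc] at this
      simp at this
    rw [this]
  | succ n ih =>
    intro v w hv hw hc
    obtain ⟨x, hx⟩ : (Finset.univ.filter fun x => v x ≠ w x).Nonempty := by
      rw [← Finset.card_pos]
      omega
    obtain ⟨q, hqv, hqw⟩ := exists_avoid v w
    rw [move_parity G hpar v hv q hqv x, move_parity G hpar w hw q hqw x]
    refine ih _ _ (hv.update hqv x) (hw.update hqw x) ?_
    have : (Finset.univ.filter fun y => Function.update v x q y ≠ Function.update w x q y) =
        (Finset.univ.filter fun y => v y ≠ w y).erase x := by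
      ext y
      by_cases hy : y = x
      · subst hy
        simp
      · simp [hy]
    rw [this, Finset.card_erase_of_mem hx, hc]
    rfl

/-- Let `G` be a graph such that for every vertex `x` and every edge `e` not
incident with `x`, the number of edges incident with `x` and disjoint from `e` is
even.  Then the parity of the number of crossings is the same for all geodesic
immersions of `G` in the sphere. -/
theorem crossing_parity_invariant {V : Type*} [Fintype V] [DecidableEq V]
    (G : SimpleGraph V) [DecidableRel G.Adj]
    (hpar : ∀ (x : V) (e : Sym2 V), e ∈ G.edgeSet → x ∉ e →
      Even ((G.edgeFinset.filter fun f => x ∈ f ∧ ∀ y ∈ e, y ∉ f).card))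
    (v w : V → E3) (hv : GoodImm v) (hw : GoodImm w) :
    (Odd (crossingNum G v) ↔ Odd (crossingNum G w)) := by
  have gv : Gen v := fun i j k h1 h2 h3 => (ind3_iff _ _ _).1 (hv.2 i j k h1 h2 h3)
  have gw : Gen w := fun i j k h1 h2 h3 => (ind3_iff _ _ _).1 (hw.2 i j k h1 h2 h3)
  have key := parity_main G hpar _ v w gv gw rfl
  rw [← ZMod.natCast_eq_one_iff_odd, ← ZMod.natCast_eq_one_iff_odd, key]

end
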